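/- (Lemma 2.4, estimate (2.5): FL¹ multilinear estimate for the Picard iterates.) There exists a constant C > 0 such that for every μ ∈ {1,−1}, every φ with φ̂ ∈ L¹(ℝ^d), every j ∈ ℕ and every t ≥ 0: ‖Θ_j(φ)(t)‖_{FL¹} ≤ C^j t^j ‖φ‖_{FL¹}^{4j+1}. -/

import Mathlib

open MeasureTheory

noncomputable section

abbrev Ed (d : ℕ) := EuclideanSpace ℝ (Fin d)

def fconv {d : ℕ} (f g : Ed d → ℂ) : Ed d → ℂ := fun ξ => ∫ η, f η * g (ξ - η)

def ftild {d : ℕ} (f : Ed d → ℂ) : Ed d → ℂ := fun η => (starRingEnd ℂ) (f (-η))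

inductive Tree5 : Type where
  | leaf : Tree5
  | node : Tree5 → Tree5 → Tree5 → Tree5 → Tree5 → Tree5

def Tree5.internal : Tree5 → ℕ
  | .leaf => 0
  | .node a b c d e => a.internal + b.internal + c.internal + d.internal + e.internal + 1

/-- The Fourier transform `F[Ψ_φ(T)(t)]` of the tree distribution, defined by recursion. -/
def FPsi (d : ℕ) (μ : ℝ) (g : Ed d → ℂ) : Tree5 → ℝ → Ed d → ℂ
  | .leaf => fun t ξ => Complex.exp (Complex.I * ((t : ℂ) * (‖ξ‖ : ℂ) ^ 4)) * g ξ
  | .node T1 T2 T3 T4 T5 => fun t ξ =>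
      Complex.I * (μ : ℂ) * Complex.exp (Complex.I * ((t : ℂ) * (‖ξ‖ : ℂ) ^ 4)) *
        ∫ τ in (0:ℝ)..t,
          Complex.exp (-(Complex.I * ((τ : ℂ) * (‖ξ‖ : ℂ) ^ 4))) *
            fconv (fconv (fconv (fconv (FPsi d μ g T1 τ) (ftild (FPsi d μ g T2 τ)))
              (FPsi d μ g T3 τ)) (ftild (FPsi d μ g T4 τ))) (FPsi d μ g T5 τ) ξ

/-- The Fourier transform of `Θ_j(φ)(t)`, the `j`-th term of the Picard series expansion. -/
def FTheta (d : ℕ) (μ : ℝ) (g : Ed d → ℂ) (j : ℕ) (t : ℝ) : Ed d → ℂ :=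
  fun ξ => ∑' T : {T : Tree5 // T.internal = j}, FPsi d μ g T t ξ

namespace Tree5

/-- The weight of a tree, each internal node contributing a factor `1 / 32`. -/
def weight (T : Tree5) : ℝ := (1 / 32) ^ T.internal

lemma weight_nonneg (T : Tree5) : 0 ≤ T.weight := by
  unfold weight; positivity

lemma weight_node (a b c d e : Tree5) :
    (node a b c d e).weight =
      1 / 32 * (a.weight * (b.weight * (c.weight * (d.weight * e.weight)))) := by
  simp only [weight, internal, pow_add, pow_one]
  ring

/-- The node constructor as an embedding of the fivefold product. -/
def nodeEmb : Tree5 × Tree5 × Tree5 × Tree5 × Tree5 ↪ Tree5 where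
  toFun p := node p.1 p.2.1 p.2.2.1 p.2.2.2.1 p.2.2.2.2
  inj' := by
    rintro ⟨a, b, c, d, e⟩ ⟨a', b', c', d', e'⟩ h
    simpa using h

lemma nodeEmb_apply (a b c d e : Tree5) : nodeEmb (a, b, c, d, e) = node a b c d e := rfl

/-- The non-leaf trees all of whose subtrees at the root lie in `D`. -/
def nodesOver (D : Finset Tree5) : Finset Tree5 :=
  (D ×ˢ D ×ˢ D ×ˢ D ×ˢ D).map nodeEmb

lemma leaf_notMem_nodesOver (D : Finset Tree5) : leaf ∉ nodesOver D := by
  simp [nodesOver, nodeEmb_apply]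

lemma node_mem_nodesOver {D : Finset Tree5} {a b c d e : Tree5} :
    node a b c d e ∈ nodesOver D ↔ a ∈ D ∧ b ∈ D ∧ c ∈ D ∧ d ∈ D ∧ e ∈ D := by
  rw [← nodeEmb_apply, nodesOver, Finset.mem_map']
  simp only [Finset.mem_product]

lemma sum_weight_nodesOver (D : Finset Tree5) :
    ∑ T ∈ nodesOver D, T.weight = 1 / 32 * (∑ T ∈ D, T.weight) ^ 5 := by
  simp only [nodesOver, Finset.sum_map, Finset.sum_product, nodeEmb_apply, weight_node,
    ← Finset.mul_sum, ← Finset.sum_mul]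
  ring

/-- The trees of height at most `n`. -/
def ofHeight : ℕ → Finset Tree5
  | 0 => {leaf}
  | n + 1 => Finset.cons leaf (nodesOver (ofHeight n)) (leaf_notMem_nodesOver _)

lemma sum_weight_ofHeight_le (n : ℕ) : ∑ T ∈ ofHeight n, T.weight ≤ 2 := by
  induction n with
  | zero => simp [ofHeight, weight, internal]
  | succ n ih =>
    have h0 : 0 ≤ ∑ T ∈ ofHeight n, T.weight := Finset.sum_nonneg fun T _ => T.weight_nonneg
    have h5 := pow_le_pow_left₀ h0 ih 5
    rw [ofHeight, Finset.sum_cons, sum_weight_nodesOver]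
    have : leaf.weight = 1 := by simp [weight, internal]
    linarith

lemma mem_ofHeight (T : Tree5) : ∀ n, T.internal ≤ n → T ∈ ofHeight n := by
  induction T with
  | leaf => intro n _; cases n <;> simp [ofHeight]
  | node a b c d e iha ihb ihc ihd ihe =>
    intro n h
    rw [internal] at h
    obtain ⟨m, rfl⟩ : ∃ m, n = m + 1 := ⟨n - 1, by omega⟩
    refine Finset.mem_cons.2 (Or.inr (node_mem_nodesOver.2 ⟨?_, ?_, ?_, ?_, ?_⟩))
    exacts [iha m (by omega), ihb m (by omega), ihc m (by omega), ihd m (by omega),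
      ihe m (by omega)]

instance finite_internal_eq (j : ℕ) : Finite {T : Tree5 // T.internal = j} :=
  Set.Finite.to_subtype
    ((ofHeight j).finite_toSet.subset fun T hT => mem_ofHeight T j (le_of_eq hT))

lemma card_internal_eq_le (j : ℕ) : Nat.card {T : Tree5 // T.internal = j} ≤ 64 ^ j := by
  classical
  have hfilter : Nat.card {T : Tree5 // T.internal = j} =
      ((ofHeight j).filter fun T => T.internal = j).card := by
    rw [← Nat.card_eq_finsetCard]
    refine Nat.card_congr (Equiv.subtypeEquivRight fun T => ?_)
    simp only [Finset.mem_filter]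
    exact ⟨fun h => ⟨mem_ofHeight T j h.le, h⟩, fun h => h.2⟩
  rw [hfilter]
  cases j with
  | zero => exact (Finset.card_filter_le _ _).trans (by simp [ofHeight])
  | succ j =>
    have hsum : ∑ T ∈ (ofHeight (j + 1)).filter (fun T => T.internal = j + 1), T.weight ≤ 2 :=
      (Finset.sum_le_sum_of_subset_of_nonneg (Finset.filter_subset _ _)
        fun T _ _ => T.weight_nonneg).trans (sum_weight_ofHeight_le _)
    rw [Finset.sum_congr rfl (g := fun _ => (1 / 32 : ℝ) ^ (j + 1))
      (fun T hT => by rw [weight, (Finset.mem_filter.1 hT).2]), Finset.sum_const,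
      nsmul_eq_mul, one_div, inv_pow, ← div_eq_mul_inv, div_le_iff₀ (by positivity)] at hsum
    have h64 : (2 : ℝ) * 32 ^ (j + 1) ≤ 64 ^ (j + 1) := by
      have h2 : (2 : ℝ) ≤ 2 ^ (j + 1) := le_self_pow₀ (by norm_num) (by omega)
      calc (2 : ℝ) * 32 ^ (j + 1) ≤ 2 ^ (j + 1) * 32 ^ (j + 1) := by gcongr
        _ = 64 ^ (j + 1) := by rw [← mul_pow]; norm_num
    exact_mod_cast hsum.trans h64

end Tree5

section Convolution

variable {d : ℕ}

lemma measurable_uncurry_fconv {F G : ℝ → Ed d → ℂ}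
    (hF : Measurable fun p : ℝ × Ed d => F p.1 p.2)
    (hG : Measurable fun p : ℝ × Ed d => G p.1 p.2) :
    Measurable fun p : ℝ × Ed d => fconv (F p.1) (G p.1) p.2 := by
  have h : Measurable fun q : (ℝ × Ed d) × Ed d => F q.1.1 q.2 * G q.1.1 (q.1.2 - q.2) :=
    (hF.comp (f := fun q : (ℝ × Ed d) × Ed d => (q.1.1, q.2)) (by fun_prop)).mul
      (hG.comp (f := fun q : (ℝ × Ed d) × Ed d => (q.1.1, q.1.2 - q.2)) (by fun_prop))
  exact h.stronglyMeasurable.integral_prod_right.measurable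

lemma measurable_uncurry_ftild {F : ℝ → Ed d → ℂ}
    (hF : Measurable fun p : ℝ × Ed d => F p.1 p.2) :
    Measurable fun p : ℝ × Ed d => ftild (F p.1) p.2 :=
  Complex.continuous_conj.measurable.comp
    (hF.comp (f := fun p : ℝ × Ed d => (p.1, -p.2)) (by fun_prop))

lemma measurable_uncurry_intervalIntegral {F : ℝ → Ed d → ℂ}
    (hF : Measurable fun p : ℝ × Ed d => F p.1 p.2) :
    Measurable fun p : ℝ × Ed d => ∫ τ in (0 : ℝ)..p.1, F τ p.2 := by
  have hF' : Measurable fun q : (ℝ × Ed d) × ℝ => F q.2 q.1.2 :=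
    hF.comp (f := fun q : (ℝ × Ed d) × ℝ => (q.2, q.1.2)) (by fun_prop)
  have key : ∀ l u : ℝ × Ed d → ℝ, Measurable l → Measurable u →
      Measurable fun p : ℝ × Ed d => ∫ τ in Set.Ioc (l p) (u p), F τ p.2 := by
    intro l u hl hu
    have hS : MeasurableSet {q : (ℝ × Ed d) × ℝ | q.2 ∈ Set.Ioc (l q.1) (u q.1)} :=
      (measurableSet_lt (hl.comp measurable_fst) measurable_snd).inter
        (measurableSet_le measurable_snd (hu.comp measurable_fst))
    have h := (hF'.indicator hS).stronglyMeasurable.integral_prod_right' (ν := volume)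
    convert h.measurable using 1
    funext p
    rw [← integral_indicator measurableSet_Ioc]
    rfl
  exact (key _ _ measurable_const measurable_fst).sub (key _ _ measurable_fst measurable_const)

lemma lintegral_enorm_fconv_le {f g : Ed d → ℂ} (hf : Measurable f) (hg : Measurable g) :
    ∫⁻ ξ, ‖fconv f g ξ‖ₑ ≤ (∫⁻ ξ, ‖f ξ‖ₑ) * ∫⁻ ξ, ‖g ξ‖ₑ := by
  calc ∫⁻ ξ, ‖fconv f g ξ‖ₑ ≤ ∫⁻ ξ, ∫⁻ η, ‖f η‖ₑ * ‖g (ξ - η)‖ₑ :=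
        lintegral_mono fun ξ => (enorm_integral_le_lintegral_enorm _).trans_eq <| by
          simp only [enorm_mul]
    _ = ∫⁻ η, ∫⁻ ξ, ‖f η‖ₑ * ‖g (ξ - η)‖ₑ := by
        refine lintegral_lintegral_swap (Measurable.aemeasurable ?_)
        exact (hf.comp measurable_snd).enorm.mul
          (hg.comp (measurable_fst.sub measurable_snd)).enorm
    _ = ∫⁻ η, ‖f η‖ₑ * ∫⁻ ξ, ‖g ξ‖ₑ := by
        refine lintegral_congr fun η => ?_
        rw [lintegral_const_mul _ (by fun_prop : Measurable fun ξ => ‖g (ξ - η)‖ₑ),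
          lintegral_sub_right_eq_self (fun ξ => ‖g ξ‖ₑ) η]
    _ = _ := lintegral_mul_const _ hf.enorm

lemma lintegral_enorm_ftild (f : Ed d → ℂ) : ∫⁻ ξ, ‖ftild f ξ‖ₑ = ∫⁻ ξ, ‖f ξ‖ₑ := by
  simp only [ftild, RCLike.enorm_conj]
  exact lintegral_neg_eq_self (fun ξ => ‖f ξ‖ₑ)

lemma fconv_congr_ae {f f' g g' : Ed d → ℂ} (hf : f =ᵐ[volume] f') (hg : g =ᵐ[volume] g') :
    fconv f g = fconv f' g' := by
  funext ξ
  refine integral_congr_ae ?_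
  have h := (Measure.measurePreserving_sub_left (volume : Measure (Ed d))
    ξ).quasiMeasurePreserving.ae_eq_comp hg
  filter_upwards [hf, h] with η h₁ h₂
  have h₃ : g (ξ - η) = g' (ξ - η) := h₂
  rw [h₁, h₃]

lemma ftild_congr_ae {f f' : Ed d → ℂ} (hf : f =ᵐ[volume] f') :
    ftild f =ᵐ[volume] ftild f' := by
  have h := (Measure.measurePreserving_neg
    (volume : Measure (Ed d))).quasiMeasurePreserving.ae_eq_comp hf
  filter_upwards [h] with η h₁
  exact congrArg (starRingEnd ℂ) h₁

/-- The quintic nonlinearity on the Fourier side. -/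
def fquintic (f₁ f₂ f₃ f₄ f₅ : Ed d → ℂ) : Ed d → ℂ :=
  fconv (fconv (fconv (fconv f₁ (ftild f₂)) f₃) (ftild f₄)) f₅

lemma measurable_uncurry_fquintic {F₁ F₂ F₃ F₄ F₅ : ℝ → Ed d → ℂ}
    (h₁ : Measurable fun p : ℝ × Ed d => F₁ p.1 p.2)
    (h₂ : Measurable fun p : ℝ × Ed d => F₂ p.1 p.2)
    (h₃ : Measurable fun p : ℝ × Ed d => F₃ p.1 p.2)
    (h₄ : Measurable fun p : ℝ × Ed d => F₄ p.1 p.2)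
    (h₅ : Measurable fun p : ℝ × Ed d => F₅ p.1 p.2) :
    Measurable fun p : ℝ × Ed d =>
      fquintic (F₁ p.1) (F₂ p.1) (F₃ p.1) (F₄ p.1) (F₅ p.1) p.2 :=
  measurable_uncurry_fconv (F := fun τ =>
      fconv (fconv (fconv (F₁ τ) (ftild (F₂ τ))) (F₃ τ)) (ftild (F₄ τ)))
    (measurable_uncurry_fconv (F := fun τ => fconv (fconv (F₁ τ) (ftild (F₂ τ))) (F₃ τ))
      (G := fun τ => ftild (F₄ τ))
      (measurable_uncurry_fconv (F := fun τ => fconv (F₁ τ) (ftild (F₂ τ)))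
        (measurable_uncurry_fconv (G := fun τ => ftild (F₂ τ)) h₁
          (measurable_uncurry_ftild h₂)) h₃)
      (measurable_uncurry_ftild h₄)) h₅

lemma measurable_fconv {f g : Ed d → ℂ} (hf : Measurable f) (hg : Measurable g) :
    Measurable (fconv f g) :=
  (measurable_uncurry_fconv (F := fun _ => f) (G := fun _ => g) (hf.comp measurable_snd)
    (hg.comp measurable_snd)).comp (measurable_prodMk_left (x := (0 : ℝ)))

lemma measurable_ftild {f : Ed d → ℂ} (hf : Measurable f) : Measurable (ftild f) :=
  Complex.continuous_conj.measurable.comp (hf.comp measurable_neg)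

lemma lintegral_enorm_fquintic_le {f₁ f₂ f₃ f₄ f₅ : Ed d → ℂ} (h₁ : Measurable f₁)
    (h₂ : Measurable f₂) (h₃ : Measurable f₃) (h₄ : Measurable f₄) (h₅ : Measurable f₅) :
    ∫⁻ ξ, ‖fquintic f₁ f₂ f₃ f₄ f₅ ξ‖ₑ ≤
      (∫⁻ ξ, ‖f₁ ξ‖ₑ) * (∫⁻ ξ, ‖f₂ ξ‖ₑ) * (∫⁻ ξ, ‖f₃ ξ‖ₑ) * (∫⁻ ξ, ‖f₄ ξ‖ₑ) *
        ∫⁻ ξ, ‖f₅ ξ‖ₑ := by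
  have m₁ := measurable_fconv h₁ (measurable_ftild h₂)
  have m₂ := measurable_fconv m₁ h₃
  have m₃ := measurable_fconv m₂ (measurable_ftild h₄)
  rw [← lintegral_enorm_ftild f₂, ← lintegral_enorm_ftild f₄]
  refine (lintegral_enorm_fconv_le m₃ h₅).trans ?_
  gcongr
  refine (lintegral_enorm_fconv_le m₂ (measurable_ftild h₄)).trans ?_
  gcongr
  refine (lintegral_enorm_fconv_le m₁ h₃).trans ?_
  gcongr
  exact lintegral_enorm_fconv_le h₁ (measurable_ftild h₂)

end Convolution

section Iterates

variable {d : ℕ} {μ : ℝ} {g : Ed d → ℂ}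

lemma enorm_exp_I_mul_norm_pow (t : ℝ) (ξ : Ed d) :
    ‖Complex.exp (Complex.I * ((t : ℂ) * (‖ξ‖ : ℂ) ^ 4))‖ₑ = 1 := by
  have h := Complex.norm_exp_I_mul_ofReal (t * ‖ξ‖ ^ 4)
  push_cast at h
  rw [← ofReal_norm, h, ENNReal.ofReal_one]

lemma FPsi_node (T₁ T₂ T₃ T₄ T₅ : Tree5) (t : ℝ) (ξ : Ed d) :
    FPsi d μ g (.node T₁ T₂ T₃ T₄ T₅) t ξ =
      Complex.I * (μ : ℂ) * Complex.exp (Complex.I * ((t : ℂ) * (‖ξ‖ : ℂ) ^ 4)) *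
        ∫ τ in (0:ℝ)..t, Complex.exp (-(Complex.I * ((τ : ℂ) * (‖ξ‖ : ℂ) ^ 4))) *
          fquintic (FPsi d μ g T₁ τ) (FPsi d μ g T₂ τ) (FPsi d μ g T₃ τ) (FPsi d μ g T₄ τ)
            (FPsi d μ g T₅ τ) ξ := rfl

lemma FPsi_congr_ae {g' : Ed d → ℂ} (h : g =ᵐ[volume] g') (T : Tree5) :
    ∀ t, FPsi d μ g T t =ᵐ[volume] FPsi d μ g' T t := by
  induction T with
  | leaf =>
    intro t
    filter_upwards [h] with ξ hξ
    simp only [FPsi, hξ]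
  | node a b c d e iha ihb ihc ihd ihe =>
    intro t
    refine Filter.Eventually.of_forall fun ξ => ?_
    simp only [FPsi, fconv_congr_ae (iha _) (ftild_congr_ae (ihb _)),
      fconv_congr_ae Filter.EventuallyEq.rfl (ihc _),
      fconv_congr_ae Filter.EventuallyEq.rfl (ftild_congr_ae (ihd _)),
      fconv_congr_ae Filter.EventuallyEq.rfl (ihe _)]

lemma measurable_uncurry_FPsi (hg : Measurable g) (T : Tree5) :
    Measurable fun p : ℝ × Ed d => FPsi d μ g T p.1 p.2 := by
  induction T with
  | leaf =>
    simp only [FPsi]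
    exact (Continuous.measurable (by fun_prop)).mul (hg.comp measurable_snd)
  | node a b c d' e iha ihb ihc ihd ihe =>
    simp only [FPsi_node]
    refine Measurable.mul (Continuous.measurable (by fun_prop)) ?_
    exact measurable_uncurry_intervalIntegral
      (F := fun τ ξ => Complex.exp (-(Complex.I * ((τ : ℂ) * (‖ξ‖ : ℂ) ^ 4))) *
          fquintic (FPsi d μ g a τ) (FPsi d μ g b τ) (FPsi d μ g c τ) (FPsi d μ g d' τ)
            (FPsi d μ g e τ) ξ)
      ((Continuous.measurable (by fun_prop)).mul
        (measurable_uncurry_fquintic iha ihb ihc ihd ihe))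

lemma measurable_FPsi (hg : Measurable g) (T : Tree5) (t : ℝ) : Measurable (FPsi d μ g T t) :=
  (measurable_uncurry_FPsi hg T).comp measurable_prodMk_left

lemma enorm_FPsi_node_le (hμ : ‖μ‖ₑ = 1) (T₁ T₂ T₃ T₄ T₅ : Tree5) {t : ℝ} (ht : 0 ≤ t)
    (ξ : Ed d) :
    ‖FPsi d μ g (.node T₁ T₂ T₃ T₄ T₅) t ξ‖ₑ ≤
      ∫⁻ τ in Set.Ioc 0 t, ‖fquintic (FPsi d μ g T₁ τ) (FPsi d μ g T₂ τ) (FPsi d μ g T₃ τ)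
        (FPsi d μ g T₄ τ) (FPsi d μ g T₅ τ) ξ‖ₑ := by
  have hI : ‖Complex.I‖ₑ = 1 := by rw [← ofReal_norm]; simp
  have hμ' : ‖(μ : ℂ)‖ₑ = 1 := by
    rw [← ofReal_norm, Complex.norm_real, ofReal_norm, hμ]
  rw [FPsi_node, enorm_mul, enorm_mul, enorm_mul, hI, hμ', enorm_exp_I_mul_norm_pow, one_mul,
    one_mul, one_mul, intervalIntegral.integral_of_le ht]
  refine (enorm_integral_le_lintegral_enorm _).trans_eq (lintegral_congr fun τ => ?_)
  have h := enorm_exp_I_mul_norm_pow (-τ) ξ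
  rw [Complex.ofReal_neg, neg_mul, mul_neg] at h
  rw [enorm_mul, h, one_mul]

lemma lintegral_enorm_FPsi_le (hμ : ‖μ‖ₑ = 1) (hg : Measurable g) (T : Tree5) :
    ∀ t : ℝ, 0 ≤ t → ∫⁻ ξ, ‖FPsi d μ g T t ξ‖ₑ ≤
      ENNReal.ofReal t ^ T.internal * (∫⁻ ξ, ‖g ξ‖ₑ) ^ (4 * T.internal + 1) := by
  set M := ∫⁻ ξ, ‖g ξ‖ₑ with hM
  induction T with
  | leaf =>
    intro t _
    simp [FPsi, Tree5.internal, enorm_mul, enorm_exp_I_mul_norm_pow, hM]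
  | node T₁ T₂ T₃ T₄ T₅ ih₁ ih₂ ih₃ ih₄ ih₅ =>
    intro t ht
    set Q : ℝ → Ed d → ℂ := fun τ => fquintic (FPsi d μ g T₁ τ) (FPsi d μ g T₂ τ)
      (FPsi d μ g T₃ τ) (FPsi d μ g T₄ τ) (FPsi d μ g T₅ τ) with hQ
    have hQm : Measurable fun p : ℝ × Ed d => Q p.1 p.2 :=
      measurable_uncurry_fquintic (measurable_uncurry_FPsi hg T₁) (measurable_uncurry_FPsi hg T₂)
        (measurable_uncurry_FPsi hg T₃) (measurable_uncurry_FPsi hg T₄)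
        (measurable_uncurry_FPsi hg T₅)
    set n := T₁.internal + T₂.internal + T₃.internal + T₄.internal + T₅.internal with hn
    have hmono : ∀ τ ∈ Set.Ioc 0 t, ∀ T : Tree5,
        (∀ s : ℝ, 0 ≤ s → ∫⁻ ξ, ‖FPsi d μ g T s ξ‖ₑ ≤
          ENNReal.ofReal s ^ T.internal * M ^ (4 * T.internal + 1)) →
        ∫⁻ ξ, ‖FPsi d μ g T τ ξ‖ₑ ≤
          ENNReal.ofReal t ^ T.internal * M ^ (4 * T.internal + 1) := by
      intro τ hτ T h
      refine (h τ hτ.1.le).trans ?_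
      gcongr
      exact hτ.2
    calc ∫⁻ ξ, ‖FPsi d μ g (.node T₁ T₂ T₃ T₄ T₅) t ξ‖ₑ
        ≤ ∫⁻ ξ, ∫⁻ τ in Set.Ioc 0 t, ‖Q τ ξ‖ₑ :=
          lintegral_mono fun ξ => enorm_FPsi_node_le hμ T₁ T₂ T₃ T₄ T₅ ht ξ
      _ = ∫⁻ τ in Set.Ioc 0 t, ∫⁻ ξ, ‖Q τ ξ‖ₑ :=
          lintegral_lintegral_swap (hQm.comp measurable_swap).enorm.aemeasurable
      _ ≤ ∫⁻ _ in Set.Ioc 0 t, ENNReal.ofReal t ^ n * M ^ (4 * n + 5) := by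
          refine setLIntegral_mono measurable_const fun τ hτ => ?_
          refine (lintegral_enorm_fquintic_le (measurable_FPsi hg T₁ τ) (measurable_FPsi hg T₂ τ)
            (measurable_FPsi hg T₃ τ) (measurable_FPsi hg T₄ τ)
            (measurable_FPsi hg T₅ τ)).trans ?_
          refine (mul_le_mul' (mul_le_mul' (mul_le_mul' (mul_le_mul' (hmono τ hτ T₁ ih₁)
            (hmono τ hτ T₂ ih₂)) (hmono τ hτ T₃ ih₃)) (hmono τ hτ T₄ ih₄))
            (hmono τ hτ T₅ ih₅)).trans_eq ?_
          rw [hn]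
          ring
      _ = _ := by
          rw [setLIntegral_const, Real.volume_Ioc, sub_zero, Tree5.internal, ← hn]
          ring

end Iterates

/-- **Lemma 2.4, estimate (2.5)**: the `FL¹` multilinear estimate
`‖Θ_j(φ)(t)‖_{FL¹} ≤ Cʲ tʲ ‖φ‖_{FL¹}^{4j+1}`, stated on the Fourier side where
`g = φ̂ ∈ L¹` and `‖φ‖_{FL^p} = ‖φ̂‖_{L^p}`. -/
theorem FL1_multilinear_estimate (d : ℕ) (hd : 1 ≤ d) :
    ∃ C > (0:ℝ), ∀ μ : ℝ, (μ = 1 ∨ μ = -1) →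
      ∀ g : Ed d → ℂ, Integrable g →
        ∀ (j : ℕ) (t : ℝ), 0 ≤ t →
          eLpNorm (FTheta d μ g j t) 1 volume ≤
            ENNReal.ofReal (C ^ j * t ^ j) * (eLpNorm g 1 volume) ^ (4 * j + 1) := by
  refine ⟨64, by norm_num, fun μ hμ g hg j t ht => ?_⟩
  have hμ' : ‖μ‖ₑ = 1 := by rcases hμ with rfl | rfl <;> simp
  obtain ⟨g', hg'm, hgg'⟩ := hg.aestronglyMeasurable
  have hae := fun T => FPsi_congr_ae (μ := μ) hgg' T t
  have hT : ∀ T : {T : Tree5 // T.internal = j}, ∫⁻ ξ, ‖FPsi d μ g T t ξ‖ₑ ≤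
      ENNReal.ofReal t ^ j * (∫⁻ ξ, ‖g ξ‖ₑ) ^ (4 * j + 1) := by
    rintro ⟨T, rfl⟩
    have h₁ : ∫⁻ ξ, ‖FPsi d μ g T t ξ‖ₑ = ∫⁻ ξ, ‖FPsi d μ g' T t ξ‖ₑ :=
      lintegral_congr_ae ((hae T).fun_comp (‖·‖ₑ))
    have h₂ : ∫⁻ ξ, ‖g ξ‖ₑ = ∫⁻ ξ, ‖g' ξ‖ₑ := lintegral_congr_ae (hgg'.fun_comp (‖·‖ₑ))
    rw [h₁, h₂]
    exact lintegral_enorm_FPsi_le hμ' hg'm.measurable T t ht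
  have : Fintype {T : Tree5 // T.internal = j} := Fintype.ofFinite _
  rw [eLpNorm_one_eq_lintegral_enorm, eLpNorm_one_eq_lintegral_enorm]
  calc ∫⁻ ξ, ‖FTheta d μ g j t ξ‖ₑ
      ≤ ∫⁻ ξ, ∑ T : {T : Tree5 // T.internal = j}, ‖FPsi d μ g T t ξ‖ₑ :=
        lintegral_mono fun ξ => by
          rw [FTheta, tsum_fintype]
          exact enorm_sum_le _ _
    _ = ∑ T : {T : Tree5 // T.internal = j}, ∫⁻ ξ, ‖FPsi d μ g T t ξ‖ₑ :=
        lintegral_finsetSum' _ fun T _ =>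
          ((measurable_FPsi hg'm.measurable T.1 t).aemeasurable.congr (hae T).symm).enorm
    _ ≤ ∑ _T : {T : Tree5 // T.internal = j},
          ENNReal.ofReal t ^ j * (∫⁻ ξ, ‖g ξ‖ₑ) ^ (4 * j + 1) :=
        Finset.sum_le_sum fun T _ => hT T
    _ = (Nat.card {T : Tree5 // T.internal = j} : ENNReal) *
          (ENNReal.ofReal t ^ j * (∫⁻ ξ, ‖g ξ‖ₑ) ^ (4 * j + 1)) := by
        rw [Finset.sum_const, nsmul_eq_mul, Finset.card_univ, Nat.card_eq_fintype_card]
    _ ≤ (64 : ENNReal) ^ j * (ENNReal.ofReal t ^ j * (∫⁻ ξ, ‖g ξ‖ₑ) ^ (4 * j + 1)) := by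
        gcongr
        exact_mod_cast Tree5.card_internal_eq_le j
    _ = _ := by
        rw [ENNReal.ofReal_mul (by positivity), ENNReal.ofReal_pow (by norm_num),
          ENNReal.ofReal_pow ht, ENNReal.ofReal_ofNat, mul_assoc]
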